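/- arXiv:2310.16600 — 8 statements merged into one kernel-verified Lean document; each statement's English description precedes it below -/
import Mathlib

section
/- Let M ≥ 1, α ∈ (0,1), and let F, F_M : ℝ → ℝ be continuous, strictly increasing functions tending to 0 at −∞ and to 1 at +∞ (continuous CDFs with inverses F⁻¹, F_M⁻¹ : (0,1) → ℝ). Let c₁, …, c_M > 0 be weights and define the quantile pooled p-value g(p) = 1 − F_M(∑_{i=1}^M c_i · F⁻¹(1 − p_i)) for p ∈ (0,1)^M. Then the central rejection level satisfies sSup {p ∈ (0,1) : g(p,…,p) ≤ α} = 1 − F( F_M⁻¹(1 − α) / (∑_{i=1}^M c_i) ). -/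
open Set Filter

/-- A strictly increasing function with limits `a` at `-∞` and `b` at `+∞` takes values in
the open interval `(a, b)`. -/
theorem StrictMono.mem_Ioo_of_tendsto {F : ℝ → ℝ} {a b : ℝ} (hF : StrictMono F)
    (hbot : Tendsto F atBot (nhds a)) (htop : Tendsto F atTop (nhds b)) (x : ℝ) :
    F x ∈ Set.Ioo a b :=
  ⟨(hF.monotone.le_of_tendsto hbot (x - 1)).trans_lt (hF (sub_one_lt x)),
    (hF (lt_add_one x)).trans_le (hF.monotone.ge_of_tendsto htop (x + 1))⟩

/-- For continuous strictly increasing CDFs `F`, `F_M` with inverses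
`Finv`, `FMinv` on `(0,1)`, positive weights `c i`, and the quantile pooled
p-value `g(p) = 1 − F_M(∑ i, c i • Finv (1 − p i))`, the central rejection level
at level `α ∈ (0,1)` is `1 − F(FMinv (1 − α) / ∑ i, c i)`. -/
theorem central_rejection_quantile_pool
    (M : ℕ) (hM : 1 ≤ M) (α : ℝ) (hα : α ∈ Set.Ioo (0 : ℝ) 1)
    (F FM : ℝ → ℝ)
    (hFcont : Continuous F) (hFmono : StrictMono F)
    (hFbot : Tendsto F atBot (nhds 0)) (hFtop : Tendsto F atTop (nhds 1))
    (hFMcont : Continuous FM) (hFMmono : StrictMono FM)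
    (hFMbot : Tendsto FM atBot (nhds 0)) (hFMtop : Tendsto FM atTop (nhds 1))
    (Finv FMinv : ℝ → ℝ)
    (hFinv : ∀ q ∈ Set.Ioo (0 : ℝ) 1, F (Finv q) = q)
    (hFMinv : ∀ q ∈ Set.Ioo (0 : ℝ) 1, FM (FMinv q) = q)
    (c : Fin M → ℝ) (hc : ∀ i, 0 < c i) :
    sSup {p : ℝ | p ∈ Set.Ioo (0 : ℝ) 1 ∧
        1 - FM (∑ i : Fin M, c i * Finv (1 - p)) ≤ α}
      = 1 - F (FMinv (1 - α) / ∑ i : Fin M, c i) := by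
  have : Nonempty (Fin M) := ⟨⟨0, hM⟩⟩
  have hC : 0 < ∑ i, c i := Finset.sum_pos (fun i _ => hc i) Finset.univ_nonempty
  have hα' : 1 - α ∈ Set.Ioo (0 : ℝ) 1 := Set.Ioo.one_sub_mem hα
  have reject_iff : ∀ p ∈ Set.Ioo (0 : ℝ) 1,
      1 - FM (∑ i, c i * Finv (1 - p)) ≤ α ↔ p ≤ 1 - F (FMinv (1 - α) / ∑ i, c i) := by
    intro p hp
    rw [sub_le_comm, ← hFMinv _ hα', hFMmono.le_iff_le, hFMinv _ hα', ← Finset.sum_mul,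
      ← div_le_iff₀' hC, ← hFmono.le_iff_le, hFinv _ (Set.Ioo.one_sub_mem hp), le_sub_comm]
  have hmem : 1 - F (FMinv (1 - α) / ∑ i, c i) ∈ Set.Ioo (0 : ℝ) 1 :=
    Set.Ioo.one_sub_mem (hFmono.mem_Ioo_of_tendsto hFbot hFtop _)
  exact IsGreatest.csSup_eq
    ⟨⟨hmem, (reject_iff _ hmem).2 le_rfl⟩, fun p hp => (reject_iff p hp.1).1 hp.2⟩
end

section
/- Let M ≥ 1, α ∈ (0,1), and let F, F_M : ℝ → ℝ be continuous, strictly increasing functions tending to 0 at −∞ and to 1 at +∞ (continuous CDFs with inverses F⁻¹, F_M⁻¹ : (0,1) → ℝ). Define the unweighted quantile pooled p-value g(p) = 1 − F_M(∑_{i=1}^M F⁻¹(1 − p_i)) for p ∈ (0,1)^M. Let b ∈ (0,1) satisfy g(b,…,b) > α. Then the marginal rejection level at b satisfies sSup {p₁ ∈ (0,b] : g(p₁, b, …, b) ≤ α} = 1 − F( F_M⁻¹(1 − α) − (M − 1)·F⁻¹(1 − b) ). -/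
open Set Filter

/-- For continuous strictly increasing CDFs `F`, `F_M` with
inverses `Finv`, `FMinv` on `(0,1)`, the unweighted quantile pooled p-value
`g(p) = 1 − F_M(∑ i, Finv (1 − p i))`, and `b ∈ (0,1)` with `g(b,…,b) > α`,
the marginal rejection level at `b` is
`1 − F(FMinv (1 − α) − (M − 1) · Finv (1 − b))`. -/
theorem marginal_rejection_quantile_pool
    (M : ℕ) (hM : 1 ≤ M) (α : ℝ) (hα : α ∈ Set.Ioo (0 : ℝ) 1)
    (F FM : ℝ → ℝ)
    (hFcont : Continuous F) (hFmono : StrictMono F)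
    (hFbot : Tendsto F atBot (nhds 0)) (hFtop : Tendsto F atTop (nhds 1))
    (hFMcont : Continuous FM) (hFMmono : StrictMono FM)
    (hFMbot : Tendsto FM atBot (nhds 0)) (hFMtop : Tendsto FM atTop (nhds 1))
    (Finv FMinv : ℝ → ℝ)
    (hFinv : ∀ q ∈ Set.Ioo (0 : ℝ) 1, F (Finv q) = q)
    (hFMinv : ∀ q ∈ Set.Ioo (0 : ℝ) 1, FM (FMinv q) = q)
    (b : ℝ) (hb : b ∈ Set.Ioo (0 : ℝ) 1)
    (hbα : α < 1 - FM ((M : ℝ) * Finv (1 - b))) :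
    sSup {p₁ : ℝ | p₁ ∈ Set.Ioc (0 : ℝ) b ∧
        1 - FM (Finv (1 - p₁) + ((M : ℝ) - 1) * Finv (1 - b)) ≤ α}
      = 1 - F (FMinv (1 - α) - ((M : ℝ) - 1) * Finv (1 - b)) := by
  set c := ((M : ℝ) - 1) * Finv (1 - b) with hc
  set y := FMinv (1 - α) with hy
  have hFb : F (Finv (1 - b)) = 1 - b := hFinv _ ⟨by linarith [hb.2], by linarith [hb.1]⟩
  have hFMy : FM y = 1 - α := hFMinv _ ⟨by linarith [hα.2], by linarith [hα.1]⟩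
  have hlt_one : F (y - c) < 1 :=
    (hFmono (lt_add_one _)).trans_le (hFmono.monotone.ge_of_tendsto hFtop _)
  have hlt_y : (M : ℝ) * Finv (1 - b) < y := hFMmono.lt_iff_lt.mp (by linarith)
  have hb_lt : 1 - b < F (y - c) := hFb ▸ hFmono (by rw [hc]; linarith)
  have hFinv_eq : Finv (F (y - c)) = y - c :=
    hFmono.injective (hFinv _ ⟨by linarith [hb.2], hlt_one⟩)
  refine IsGreatest.csSup_eq ⟨⟨⟨by linarith, by linarith⟩, ?_⟩, ?_⟩
  · rw [sub_sub_cancel, hFinv_eq, sub_add_cancel, hFMy, sub_sub_cancel]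
  · rintro p ⟨⟨hp0, hpb⟩, hp⟩
    have hle : y ≤ Finv (1 - p) + c := hFMmono.le_iff_le.mp (by linarith)
    have hF_le : F (y - c) ≤ F (Finv (1 - p)) := hFmono.monotone (by linarith)
    rw [hFinv _ ⟨by linarith [hb.2], by linarith⟩] at hF_le
    linarith
end

section
/- Let M ≥ 2 be a natural number and α ∈ (0,1). For b ∈ (0,1) define s(b) = sSup {p₁ ∈ (0,b] : 1 − Φ( (Φ⁻¹(1 − p₁) + (M − 1)·Φ⁻¹(1 − b)) / √M ) ≤ α} (with sSup ∅ = 0). Then s(b) tends to 0 as b → 1⁻; that is, the marginal rejection level of Stouffer's pooled p-value is p_r(Sto) = 0. -/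
open Set Filter Topology

/-- The CDF `Φ` of the standard normal distribution. -/
noncomputable def stdNormCDF : ℝ → ℝ :=
  fun x => ProbabilityTheory.cdf (ProbabilityTheory.gaussianReal 0 1) x

/-- The inverse `Φ⁻¹` (quantile function) of the standard normal CDF. -/
noncomputable def stdNormInv (q : ℝ) : ℝ := sInf {x : ℝ | q ≤ stdNormCDF x}

open ProbabilityTheory MeasureTheory in
theorem stdNormCDF_pos (x : ℝ) : 0 < stdNormCDF x := by
  have hac : volume ≪ gaussianReal 0 1 := gaussianReal_absolutelyContinuous' 0 one_ne_zero
  rw [stdNormCDF, cdf_eq_real, measureReal_def]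
  exact ENNReal.toReal_pos (fun h => by simpa using hac h) (measure_ne_top _ _)

theorem stdNormCDF_mono : Monotone stdNormCDF :=
  ProbabilityTheory.monotone_cdf _

theorem stdNormInv_le {q x : ℝ} (hq : 0 < q) (hx : q ≤ stdNormCDF x) : stdNormInv q ≤ x := by
  obtain ⟨y, hy⟩ := ((ProbabilityTheory.tendsto_cdf_atBot
    (ProbabilityTheory.gaussianReal 0 1)).eventually_lt_const hq).exists
  refine csInf_le ⟨y, fun z hz => ?_⟩ hx
  by_contra! hzy
  exact absurd (hz.trans (stdNormCDF_mono hzy.le)) (not_le.mpr hy)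

/-- For `M ≥ 2` and `α ∈ (0,1)`, the marginal rejection level at `b`
of Stouffer's pooled p-value,
`s(b) = sSup {p₁ ∈ (0,b] : 1 − Φ((Φ⁻¹(1−p₁) + (M−1)Φ⁻¹(1−b))/√M) ≤ α}`,
tends to `0` as `b → 1⁻`; that is, `p_r(Sto) = 0`. -/
theorem stouffer_marginal_rejection_zero
    (M : ℕ) (hM : 2 ≤ M) (α : ℝ) (hα : α ∈ Set.Ioo (0 : ℝ) 1) :
    Tendsto (fun b : ℝ =>
        sSup {p₁ : ℝ | p₁ ∈ Set.Ioc (0 : ℝ) b ∧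
          1 - stdNormCDF ((stdNormInv (1 - p₁) + ((M : ℝ) - 1) * stdNormInv (1 - b))
              / Real.sqrt M) ≤ α})
      (nhdsWithin 1 (Set.Iio 1)) (nhds 0) := by
  have hM1 : (0 : ℝ) < M - 1 := by
    have : (2 : ℝ) ≤ M := by exact_mod_cast hM
    linarith
  have hs : 0 < √(M : ℝ) := Real.sqrt_pos.mpr (by linarith)
  rw [Metric.tendsto_nhds]
  intro ε hε
  obtain ⟨C, hC⟩ := ((ProbabilityTheory.tendsto_cdf_atTop
    (ProbabilityTheory.gaussianReal 0 1)).eventually_const_lt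
      (show 1 - ε / 2 < 1 by linarith)).exists
  obtain ⟨L, hL⟩ := ((ProbabilityTheory.tendsto_cdf_atBot
    (ProbabilityTheory.gaussianReal 0 1)).eventually_lt_const
      (show 0 < 1 - α by linarith [hα.2])).exists
  change 1 - ε / 2 < stdNormCDF C at hC
  change stdNormCDF L < 1 - α at hL
  set K := (L * √(M : ℝ) - C) / ((M : ℝ) - 1) with hK
  have hKL : C + ((M : ℝ) - 1) * K = L * √(M : ℝ) := by
    rw [hK]; field_simp; ring
  have hb : ∀ᶠ b : ℝ in 𝓝[<] 1, 1 - stdNormCDF K < b :=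
    nhdsWithin_le_nhds (lt_mem_nhds (by linarith [stdNormCDF_pos K]))
  filter_upwards [hb, self_mem_nhdsWithin] with b hb1 (hb2 : b < 1)
  have hInv : stdNormInv (1 - b) ≤ K := stdNormInv_le (by linarith) (by linarith)
  rw [Real.dist_0_eq_abs, abs_of_nonneg (Real.sSup_nonneg fun p hp => hp.1.1.le)]
  refine (Real.sSup_le (fun p hp => ?_) (half_pos hε).le).trans_lt (half_lt_self hε)
  obtain ⟨⟨-, hpb⟩, hp⟩ := hp
  by_contra! hpε
  have hInvp : stdNormInv (1 - p) ≤ C := stdNormInv_le (by linarith) (by linarith)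
  have hle : (stdNormInv (1 - p) + ((M : ℝ) - 1) * stdNormInv (1 - b)) / √(M : ℝ) ≤ L := by
    rw [div_le_iff₀ hs, ← hKL]
    gcongr
  linarith [stdNormCDF_mono hle]
end

section
/- Let M ≥ 1 be a natural number, α ∈ (0,1), and set t = 1 − (1 − α)^(1/M) (real power). Define Tippett's pooled p-value Tip(p) = 1 − (1 − min_i p_i)^M for p ∈ [0,1]^M. For every b ∈ [0,1]: if b < t then sSup {p₁ ∈ [0,b] : Tip(p₁, b, …, b) ≤ α} = b, and if b ≥ t then sSup {p₁ ∈ [0,b] : Tip(p₁, b, …, b) ≤ α} = t. -/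
open Set

/-- Tippett's pooled p-value `Tip(p) = 1 − (1 − min_i p_i)^M`. -/
noncomputable def tippett (M : ℕ) (p : Fin M → ℝ) : ℝ := 1 - (1 - ⨅ i, p i) ^ M

theorem ciInf_update_const_of_le {ι : Type*} [Finite ι] [DecidableEq ι] (i : ι) {a b : ℝ}
    (hab : a ≤ b) : ⨅ j, Function.update (fun _ => b) i a j = a := by
  have : Nonempty ι := ⟨i⟩
  refine le_antisymm ?_ (le_ciInf fun j => ?_)
  · simpa using ciInf_le (Set.finite_range (Function.update (fun _ => b) i a)).bddBelow i
  · rcases eq_or_ne j i with rfl | hj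
    · simp
    · simpa [hj] using hab

theorem one_sub_one_sub_pow_le_iff {M : ℕ} (hM : 1 ≤ M) {α a : ℝ} (hα : α ≤ 1) (ha : a ≤ 1) :
    1 - (1 - a) ^ M ≤ α ↔ a ≤ 1 - (1 - α) ^ ((1 : ℝ) / M) := by
  have h := Real.rpow_inv_le_iff_of_pos (sub_nonneg.2 hα) (sub_nonneg.2 ha)
    (Nat.cast_pos.2 hM : (0 : ℝ) < M)
  rw [Real.rpow_natCast] at h
  rw [one_div, sub_le_comm, ← h, le_sub_comm]

/-- For `M ≥ 1`, `α ∈ (0,1)` and `t = 1 − (1 − α)^(1/M)`, the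
marginal rejection level of Tippett's pooled p-value at `b ∈ [0,1]` is `b` when
`b < t` and `t` when `b ≥ t`. -/
theorem tippett_marginal_rejection
    (M : ℕ) (hM : 1 ≤ M) (α : ℝ) (hα : α ∈ Set.Ioo (0 : ℝ) 1)
    (t : ℝ) (ht : t = 1 - (1 - α) ^ ((1 : ℝ) / M))
    (b : ℝ) (hb : b ∈ Set.Icc (0 : ℝ) 1) :
    (b < t →
      sSup {p₁ : ℝ | p₁ ∈ Set.Icc (0 : ℝ) b ∧
        tippett M (Function.update (fun _ => b) ⟨0, hM⟩ p₁) ≤ α} = b) ∧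
    (t ≤ b →
      sSup {p₁ : ℝ | p₁ ∈ Set.Icc (0 : ℝ) b ∧
        tippett M (Function.update (fun _ => b) ⟨0, hM⟩ p₁) ≤ α} = t) := by
  have ht0 : 0 ≤ t := by
    rw [ht, ← one_sub_one_sub_pow_le_iff hM hα.2.le zero_le_one]
    simpa using hα.1.le
  have hset : {p₁ : ℝ | p₁ ∈ Set.Icc (0 : ℝ) b ∧
      tippett M (Function.update (fun _ => b) ⟨0, hM⟩ p₁) ≤ α} = Set.Icc 0 (min b t) := by
    ext p
    simp only [Set.mem_ofPred_eq, Set.mem_Icc, le_min_iff, ← and_assoc]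
    refine and_congr_right fun hp => ?_
    rw [tippett, ciInf_update_const_of_le _ hp.2,
      one_sub_one_sub_pow_le_iff hM hα.2.le (hp.2.trans hb.2), ht]
  rw [hset, csSup_Icc (le_min hb.1 ht0)]
  exact ⟨fun h => min_eq_left h.le, min_eq_right⟩
end

section
/- Let M ≥ 1 be a natural number and p ∈ (0,1)^M. Then, as the real degrees-of-freedom parameter κ → ∞, the chi-squared quantile pooled p-value converges to Stouffer's pooled p-value: lim_{κ→∞} [ 1 − F_χ( ∑_{i=1}^M F_χ⁻¹(1 − p_i; κ); Mκ ) ] = 1 − Φ( (1/√M) ∑_{i=1}^M Φ⁻¹(1 − p_i) ). -/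
open Set Filter Topology

/-- `F_χ(·;κ)`: the CDF of the chi-squared distribution with real degrees of
freedom `κ`, i.e. of the Gamma distribution with shape `κ/2` and rate `1/2`. -/
noncomputable def chiSqCDF (κ : ℝ) : ℝ → ℝ :=
  fun x => ProbabilityTheory.cdf (ProbabilityTheory.gammaMeasure (κ / 2) (1 / 2)) x

/-- `F_χ⁻¹(q;κ)`: the quantile function of the chi-squared distribution. -/
noncomputable def chiSqInv (κ : ℝ) (q : ℝ) : ℝ := sInf {x : ℝ | q ≤ chiSqCDF κ x}

section ChiSqLimit

open MeasureTheory ProbabilityTheory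

section GammaMeasure

open Complex (I)

lemma integrable_gammaPDFReal {a r : ℝ} (ha : 0 < a) (hr : 0 < r) :
    Integrable (gammaPDFReal a r) := by
  refine ⟨(measurable_gammaPDFReal a r).aestronglyMeasurable, ?_⟩
  rw [hasFiniteIntegral_iff_ofReal (ae_of_all _ (gammaPDFReal_nonneg ha hr))]
  exact (lintegral_gammaPDF_eq_one ha hr).trans_lt ENNReal.one_lt_top

lemma integral_gammaPDFReal {a r : ℝ} (ha : 0 < a) (hr : 0 < r) :
    ∫ x, gammaPDFReal a r x = 1 := by
  rw [integral_eq_lintegral_of_nonneg_ae (ae_of_all _ (gammaPDFReal_nonneg ha hr))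
    (measurable_gammaPDFReal a r).aestronglyMeasurable]
  exact congrArg ENNReal.toReal (lintegral_gammaPDF_eq_one ha hr)

lemma gammaPDFReal_mul_exp {a r t : ℝ} (hr : 0 < r) (ht : t < r) (x : ℝ) :
    gammaPDFReal a r x * Real.exp (t * x) =
      (1 - t / r) ^ (-a) * gammaPDFReal a (r - t) x := by
  unfold gammaPDFReal
  split_ifs with hx
  · have hrt : 0 < r - t := sub_pos.2 ht
    have h : 1 - t / r = (r - t) / r := by field_simp
    have hexp : Real.exp (-((r - t) * x)) = Real.exp (-(r * x)) * Real.exp (t * x) := by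
      rw [← Real.exp_add]; ring_nf
    rw [h, Real.rpow_neg (by positivity), Real.div_rpow hrt.le hr.le, hexp]
    have : 0 < (r - t) ^ a := Real.rpow_pos_of_pos hrt a
    field_simp
  · simp

lemma integrable_exp_mul_gammaMeasure {a r t : ℝ} (ha : 0 < a) (hr : 0 < r) (ht : t < r) :
    Integrable (fun x ↦ Real.exp (t * x)) (gammaMeasure a r) := by
  unfold gammaMeasure gammaPDF
  rw [integrable_withDensity_iff_integrable_smul'
    (measurable_gammaPDFReal a r).ennreal_ofReal (ae_of_all _ fun _ ↦ ENNReal.ofReal_lt_top)]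
  simp_rw [ENNReal.toReal_ofReal (gammaPDFReal_nonneg ha hr _), smul_eq_mul,
    gammaPDFReal_mul_exp hr ht]
  exact (integrable_gammaPDFReal ha (sub_pos.2 ht)).const_mul _

lemma mgf_gammaMeasure {a r t : ℝ} (ha : 0 < a) (hr : 0 < r) (ht : t < r) :
    mgf id (gammaMeasure a r) t = (1 - t / r) ^ (-a) := by
  unfold mgf gammaMeasure gammaPDF
  rw [integral_withDensity_eq_integral_toReal_smul
    (measurable_gammaPDFReal a r).ennreal_ofReal (ae_of_all _ fun _ ↦ ENNReal.ofReal_lt_top)]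
  simp_rw [ENNReal.toReal_ofReal (gammaPDFReal_nonneg ha hr _), smul_eq_mul, id,
    gammaPDFReal_mul_exp hr ht]
  rw [integral_const_mul, integral_gammaPDFReal ha (sub_pos.2 ht), mul_one]

lemma Iio_subset_interior_integrableExpSet_gammaMeasure {a r : ℝ} (ha : 0 < a) (hr : 0 < r) :
    Iio r ⊆ interior (integrableExpSet id (gammaMeasure a r)) :=
  interior_maximal (fun _ ht ↦ integrable_exp_mul_gammaMeasure ha hr ht) isOpen_Iio

lemma complexMGF_gammaMeasure {a r : ℝ} (ha : 0 < a) (hr : 0 < r) {z : ℂ} (hz : z.re < r) :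
    complexMGF id (gammaMeasure a r) z = (1 - z / r) ^ (-a : ℂ) := by
  have hf : AnalyticOnNhd ℂ (complexMGF id (gammaMeasure a r)) {z | z.re < r} :=
    analyticOnNhd_complexMGF.mono fun _ hz ↦
      Iio_subset_interior_integrableExpSet_gammaMeasure ha hr hz
  have hg : AnalyticOnNhd ℂ (fun z : ℂ ↦ (1 - z / r) ^ (-a : ℂ)) {z | z.re < r} := by
    intro z hz
    refine AnalyticAt.cpow (by fun_prop) analyticAt_const (Or.inl ?_)
    simpa [Complex.div_ofReal_re, div_lt_one hr] using hz
  refine AnalyticOnNhd.eqOn_of_preconnected_of_frequently_eq hf hg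
    (convex_halfSpace_re_lt r).isPreconnected (z₀ := 0) (by simpa using hr) ?_ hz
  have hreal : ∀ᶠ x : ℝ in 𝓝[≠] 0,
      complexMGF id (gammaMeasure a r) x = (1 - (x : ℂ) / r) ^ (-a : ℂ) := by
    filter_upwards [nhdsWithin_le_nhds (Iio_mem_nhds hr)] with x hx
    have : 0 ≤ 1 - x / r := by
      rw [sub_nonneg, div_le_one hr]; exact le_of_lt hx
    rw [complexMGF_ofReal, mgf_gammaMeasure ha hr hx, Complex.ofReal_cpow this]
    push_cast
    rfl
  have hmap : Tendsto ((↑) : ℝ → ℂ) (𝓝[≠] 0) (𝓝[≠] 0) := by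
    refine tendsto_nhdsWithin_of_tendsto_nhds_of_eventually_within _ ?_ ?_
    · exact (Complex.continuous_ofReal.tendsto' 0 0 (by simp)).mono_left nhdsWithin_le_nhds
    · filter_upwards [self_mem_nhdsWithin] with x hx
      simpa using hx
  exact hmap.frequently hreal.frequently

lemma charFun_gammaMeasure {a r : ℝ} (ha : 0 < a) (hr : 0 < r) (t : ℝ) :
    charFun (gammaMeasure a r) t = (1 - t * I / r) ^ (-a : ℂ) := by
  rw [← complexMGF_id_mul_I, complexMGF_gammaMeasure ha hr (by simpa using hr)]

end GammaMeasure

section ChiSqCLT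

open Complex (I)

/-- The chi-squared distribution with `κ` degrees of freedom, centred at its mean `κ` and scaled by
its standard deviation `√(2κ)`. -/
noncomputable def standardizedChiSq (κ : ℝ) : Measure ℝ :=
  (gammaMeasure (κ / 2) (1 / 2)).map (fun x ↦ (√(2 * κ))⁻¹ * (x + -κ))

lemma isProbabilityMeasure_standardizedChiSq {κ : ℝ} (hκ : 0 < κ) :
    IsProbabilityMeasure (standardizedChiSq κ) := by
  have := isProbabilityMeasure_gammaMeasure (half_pos hκ) (one_half_pos (α := ℝ))
  exact Measure.isProbabilityMeasure_map (by fun_prop)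

lemma cdf_standardizedChiSq {κ : ℝ} (hκ : 0 < κ) (z : ℝ) :
    cdf (standardizedChiSq κ) z = chiSqCDF κ (κ + √(2 * κ) * z) := by
  have := isProbabilityMeasure_gammaMeasure (half_pos hκ) (one_half_pos (α := ℝ))
  have := isProbabilityMeasure_standardizedChiSq hκ
  rw [chiSqCDF, cdf_eq_real, cdf_eq_real, standardizedChiSq,
    map_measureReal_apply (by fun_prop) measurableSet_Iic]
  congr 1
  ext x
  have hs : 0 < √(2 * κ) := by positivity
  simp only [mem_preimage, mem_Iic, inv_mul_le_iff₀ hs]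
  constructor <;> intro h <;> linarith

lemma charFun_standardizedChiSq {κ : ℝ} (hκ : 0 < κ) (t : ℝ) :
    charFun (standardizedChiSq κ) t =
      Complex.exp (-(κ / 2) * (Complex.log (1 + (-2 * (√(2 * κ))⁻¹ * t * I)) -
        (-2 * (√(2 * κ))⁻¹ * t * I))) := by
  rw [standardizedChiSq, charFun_map_mul_comp (by fun_prop), charFun_map_add_const,
    charFun_gammaMeasure (half_pos hκ) one_half_pos]
  have h0 : (1 + (-2 * (√(2 * κ))⁻¹ * t * I) : ℂ) ≠ 0 := by
    intro h
    simpa using congrArg Complex.re h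
  have h1 : (1 - ((√(2 * κ))⁻¹ * t : ℝ) * I / (1 / 2 : ℝ) : ℂ) =
      1 + (-2 * (√(2 * κ))⁻¹ * t * I) := by
    push_cast; ring
  rw [h1, Complex.cpow_def_of_ne_zero h0, ← Complex.exp_add]
  congr 1
  simp only [Real.inner_apply]
  push_cast
  ring

lemma tendsto_charFun_standardizedChiSq (t : ℝ) :
    Tendsto (fun κ ↦ charFun (standardizedChiSq κ) t) atTop
      (𝓝 (charFun (gaussianReal 0 1) t)) := by
  set w : ℝ → ℂ := fun κ ↦ -2 * (√(2 * κ))⁻¹ * t * I with hw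
  have hw0 : Tendsto w atTop (𝓝 0) := by
    have h : Tendsto (fun κ : ℝ ↦ (√(2 * κ))⁻¹) atTop (𝓝 0) :=
      tendsto_inv_atTop_zero.comp
        (Real.tendsto_sqrt_atTop.comp (tendsto_id.const_mul_atTop two_pos))
    have h' := (Complex.continuous_ofReal.tendsto' 0 0 (by simp)).comp h
    simpa [hw, Function.comp_def] using ((h'.const_mul (-2)).mul_const (t : ℂ)).mul_const I
  have hw2 : ∀ᶠ κ : ℝ in atTop, (κ : ℂ) * w κ ^ 2 = -2 * t ^ 2 := by
    filter_upwards [eventually_gt_atTop 0] with κ hκ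
    have hs : ((√(2 * κ) : ℝ) : ℂ) ^ 2 = 2 * κ := by
      rw [← Complex.ofReal_pow, Real.sq_sqrt (by positivity)]; push_cast; rfl
    have hκ' : (κ : ℂ) ≠ 0 := by exact_mod_cast hκ.ne'
    simp only [hw, mul_pow, Complex.I_sq, Complex.ofReal_inv, inv_pow, hs]
    field_simp
  have hR : Tendsto (fun κ : ℝ ↦ (κ : ℂ) * (Complex.log (1 + w κ) - Complex.logTaylor 3 (w κ)))
      atTop (𝓝 0) := by
    have hO := (Complex.log_sub_logTaylor_isBigO 2).comp_tendsto hw0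
    have hO' := (Asymptotics.isBigO_refl (fun κ : ℝ ↦ (κ : ℂ)) atTop).mul hO
    refine hO'.trans_tendsto ?_
    have : Tendsto (fun κ ↦ (-2 * t ^ 2 : ℂ) * w κ) atTop (𝓝 0) := by
      simpa only [mul_zero] using hw0.const_mul (-2 * t ^ 2 : ℂ)
    refine this.congr' ?_
    filter_upwards [hw2] with κ hκ
    simp only [Function.comp_apply]
    rw [← hκ]; ring
  have hlim : Tendsto (fun κ : ℝ ↦ Complex.exp (-(t ^ 2 / 2) +
      -(1 / 2) * ((κ : ℂ) * (Complex.log (1 + w κ) - Complex.logTaylor 3 (w κ)))))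
      atTop (𝓝 (Complex.exp (-(t ^ 2 / 2) + -(1 / 2) * 0))) :=
    (Complex.continuous_exp.tendsto _).comp ((hR.const_mul _).const_add _)
  have hgauss : charFun (gaussianReal 0 1) t = Complex.exp (-(t ^ 2 / 2) + -(1 / 2) * 0) := by
    rw [charFun_gaussianReal]; congr 1; simp
  rw [hgauss]
  refine hlim.congr' ?_
  filter_upwards [hw2, eventually_gt_atTop 0] with κ hκ hpos
  rw [charFun_standardizedChiSq hpos]
  congr 1
  change _ = -((κ : ℂ) / 2) * (Complex.log (1 + w κ) - w κ)
  simp only [Complex.logTaylor_succ, Complex.logTaylor_zero, Pi.add_apply]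
  push_cast
  linear_combination (-1 / 4 : ℂ) * hκ

lemma tendsto_cdf_of_tendsto_charFun {μ : ℕ → Measure ℝ} {ν : Measure ℝ}
    [∀ n, IsProbabilityMeasure (μ n)] [IsProbabilityMeasure ν]
    (h : ∀ t, Tendsto (fun n ↦ charFun (μ n) t) atTop (𝓝 (charFun ν t)))
    {x : ℝ} (hx : ν {x} = 0) :
    Tendsto (fun n ↦ cdf (μ n) x) atTop (𝓝 (cdf ν x)) := by
  have hlim := ProbabilityMeasure.tendsto_of_tendsto_charFun
    (μ := fun n ↦ ⟨μ n, inferInstance⟩) (μ₀ := ⟨ν, inferInstance⟩) h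
  have key := ProbabilityMeasure.tendsto_measure_of_null_frontier_of_tendsto' hlim
    (E := Iic x) (by simpa using hx)
  simp_rw [cdf_eq_real]
  exact (ENNReal.tendsto_toReal (measure_ne_top ν _)).comp key

/-- Central limit theorem for the chi-squared distribution with real degrees of freedom. -/
lemma tendsto_chiSqCDF (z : ℝ) :
    Tendsto (fun κ ↦ chiSqCDF κ (κ + √(2 * κ) * z)) atTop (𝓝 (stdNormCDF z)) := by
  refine tendsto_of_seq_tendsto fun u hu ↦ ?_
  have hpos (n : ℕ) : 0 < max (u n) 1 := lt_max_of_lt_right one_pos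
  have := fun n ↦ isProbabilityMeasure_standardizedChiSq (hpos n)
  have := nullSingletonClass_gaussianReal (μ := 0) (one_ne_zero (α := NNReal))
  have hmax : Tendsto (fun n ↦ max (u n) 1) atTop atTop :=
    tendsto_atTop_mono (fun _ ↦ le_max_left _ _) hu
  refine (tendsto_cdf_of_tendsto_charFun (ν := gaussianReal 0 1)
    (fun t ↦ (tendsto_charFun_standardizedChiSq t).comp hmax) (measure_singleton z)).congr' ?_
  filter_upwards [hu.eventually_ge_atTop 1] with n hn
  rw [cdf_standardizedChiSq (hpos n), max_eq_left hn]
  rfl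

end ChiSqCLT

lemma strictMono_stdNormCDF : StrictMono stdNormCDF := by
  intro x y hxy
  have hpos : gaussianReal 0 1 (Ioc x y) ≠ 0 := fun h ↦ by
    have := gaussianReal_absolutelyContinuous' 0 (one_ne_zero (α := NNReal)) h
    rw [Real.volume_Ioc, ENNReal.ofReal_eq_zero] at this
    linarith
  rw [← measure_cdf (gaussianReal 0 1), StieltjesFunction.measure_Ioc] at hpos
  simpa [stdNormCDF] using hpos

lemma continuous_stdNormCDF : Continuous stdNormCDF := by
  have := nullSingletonClass_gaussianReal (μ := 0) (one_ne_zero (α := NNReal))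
  refine continuous_iff_continuousAt.2 fun x ↦
    continuousAt_iff_continuous_left_right.2 ⟨?_, (cdf (gaussianReal 0 1)).right_continuous x⟩
  have hx : (cdf (gaussianReal 0 1)).measure {x} = 0 := by
    rw [measure_cdf]; exact measure_singleton x
  rw [StieltjesFunction.measure_singleton, ENNReal.ofReal_eq_zero, sub_nonpos] at hx
  have hlim := (monotone_cdf (gaussianReal 0 1)).leftLim_le (le_refl x)
  exact continuousWithinAt_Iio_iff_Iic.1
    ((monotone_cdf (gaussianReal 0 1)).continuousWithinAt_Iio_iff_leftLim_eq.2
      (le_antisymm hlim hx))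

lemma stdNormCDF_stdNormInv {q : ℝ} (hq : q ∈ Ioo (0 : ℝ) 1) : stdNormCDF (stdNormInv q) = q := by
  obtain ⟨z, hz⟩ : ∃ z, stdNormCDF z = q := by
    obtain ⟨a, ha⟩ := ((tendsto_cdf_atBot (gaussianReal 0 1)).eventually_lt_const hq.1).exists
    obtain ⟨b, hb⟩ := ((tendsto_cdf_atTop (gaussianReal 0 1)).eventually_const_lt hq.2).exists
    exact mem_range_of_exists_le_of_exists_ge continuous_stdNormCDF ⟨a, ha.le⟩ ⟨b, hb.le⟩
  have : {x | q ≤ stdNormCDF x} = Ici z := by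
    ext x
    rw [← hz]
    exact strictMono_stdNormCDF.le_iff_le
  rw [stdNormInv, this, csInf_Ici, hz]

lemma monotone_chiSqCDF (κ : ℝ) : Monotone (chiSqCDF κ) := monotone_cdf _

/-- The standardized chi-squared quantiles converge to the standard normal quantiles. -/
lemma tendsto_standardized_chiSqInv {q : ℝ} (hq : q ∈ Ioo (0 : ℝ) 1) :
    Tendsto (fun κ ↦ (chiSqInv κ q - κ) / √(2 * κ)) atTop (𝓝 (stdNormInv q)) := by
  set z := stdNormInv q
  have hz : stdNormCDF z = q := stdNormCDF_stdNormInv hq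
  have below {a : ℝ} (ha : a < z) : ∀ᶠ κ in atTop, chiSqCDF κ (κ + √(2 * κ) * a) < q :=
    (tendsto_chiSqCDF a).eventually_lt_const (hz ▸ strictMono_stdNormCDF ha)
  have above {b : ℝ} (hb : z < b) : ∀ᶠ κ in atTop, q < chiSqCDF κ (κ + √(2 * κ) * b) :=
    (tendsto_chiSqCDF b).eventually_const_lt (hz ▸ strictMono_stdNormCDF hb)
  have lower {κ x : ℝ} (h : chiSqCDF κ x < q) : x ∈ lowerBounds {y | q ≤ chiSqCDF κ y} :=
    fun _ hy ↦ ((monotone_chiSqCDF κ).reflect_lt (h.trans_le hy)).le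
  refine tendsto_order.2 ⟨fun a ha ↦ ?_, fun b hb ↦ ?_⟩
  · obtain ⟨c, hac, hcz⟩ := exists_between ha
    filter_upwards [below hcz, above (lt_add_one z), eventually_gt_atTop 0] with κ hc h1 hκ
    have hs : 0 < √(2 * κ) := by positivity
    have : κ + √(2 * κ) * c ≤ chiSqInv κ q := le_csInf ⟨_, h1.le⟩ (lower hc)
    rw [lt_div_iff₀ hs]
    nlinarith
  · obtain ⟨c, hzc, hcb⟩ := exists_between hb
    filter_upwards [above hzc, below (sub_one_lt z), eventually_gt_atTop 0] with κ hc h1 hκ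
    have hs : 0 < √(2 * κ) := by positivity
    have : chiSqInv κ q ≤ κ + √(2 * κ) * c := csInf_le ⟨_, lower h1⟩ hc.le
    rw [div_lt_iff₀ hs]
    nlinarith

/-- The convergence in the central limit theorem is locally uniform in the argument. -/
lemma tendsto_chiSqCDF_of_tendsto {w : ℝ → ℝ} {z : ℝ} (hw : Tendsto w atTop (𝓝 z)) :
    Tendsto (fun κ ↦ chiSqCDF κ (κ + √(2 * κ) * w κ)) atTop (𝓝 (stdNormCDF z)) := by
  refine tendsto_order.2 ⟨fun a ha ↦ ?_, fun b hb ↦ ?_⟩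
  · obtain ⟨c, hcz, hc⟩ :=
      ((continuous_stdNormCDF.tendsto z).eventually_const_lt ha).exists_lt
    filter_upwards [hw.eventually_const_lt hcz, (tendsto_chiSqCDF c).eventually_const_lt hc]
      with κ h1 h2
    exact h2.trans_le (monotone_chiSqCDF κ (by gcongr))
  · obtain ⟨c, hcz, hc⟩ :=
      ((continuous_stdNormCDF.tendsto z).eventually_lt_const hb).exists_gt
    filter_upwards [hw.eventually_lt_const hcz, (tendsto_chiSqCDF c).eventually_lt_const hc]
      with κ h1 h2
    exact (monotone_chiSqCDF κ (by gcongr)).trans_lt h2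

end ChiSqLimit

/-- For `M ≥ 1` and `p ∈ (0,1)^M`, as `κ → ∞` the chi-squared
quantile pooled p-value converges to Stouffer's pooled p-value:
`1 − F_χ(∑ i, F_χ⁻¹(1 − p_i; κ); Mκ) → 1 − Φ((∑ i, Φ⁻¹(1 − p_i))/√M)`. -/
theorem chiPool_tendsto_stouffer
    (M : ℕ) (hM : 1 ≤ M) (p : Fin M → ℝ) (hp : ∀ i, p i ∈ Set.Ioo (0 : ℝ) 1) :
    Tendsto (fun κ : ℝ =>
        1 - chiSqCDF ((M : ℝ) * κ) (∑ i : Fin M, chiSqInv κ (1 - p i)))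
      atTop
      (nhds (1 - stdNormCDF ((∑ i : Fin M, stdNormInv (1 - p i)) / Real.sqrt M))) := by
  have hq (i : Fin M) : 1 - p i ∈ Ioo (0 : ℝ) 1 :=
    ⟨by linarith [(hp i).2], by linarith [(hp i).1]⟩
  have hM0 : (0 : ℝ) < M := by exact_mod_cast hM
  set q : ℝ → ℝ := fun κ ↦ ∑ i : Fin M, chiSqInv κ (1 - p i) with hqdef
  have hsum : Tendsto (fun κ ↦ (q κ - M * κ) / √(2 * (M * κ))) atTop
      (𝓝 ((∑ i : Fin M, stdNormInv (1 - p i)) / √M)) := by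
    refine ((tendsto_finsetSum Finset.univ
      fun i _ ↦ tendsto_standardized_chiSqInv (hq i)).div_const √M).congr fun κ ↦ ?_
    rw [← Finset.sum_div, Finset.sum_sub_distrib, mul_left_comm, Real.sqrt_mul hM0.le, div_div,
      mul_comm √(M : ℝ)]
    simp [hqdef]
  have hMκ : Tendsto (fun κ : ℝ ↦ κ / M) atTop atTop := tendsto_id.atTop_div_const hM0
  have hlim := (tendsto_chiSqCDF_of_tendsto (hsum.comp hMκ)).comp
    (tendsto_id.const_mul_atTop hM0)
  refine (hlim.congr' ?_).const_sub 1
  filter_upwards [eventually_gt_atTop 0] with κ hκ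
  have hs : √(2 * (M * κ)) ≠ 0 := by positivity
  simp only [Function.comp_apply, id_eq, mul_div_cancel_left₀ κ hM0.ne']
  rw [mul_div_cancel₀ _ hs, add_sub_cancel]
end

section
/- Fix a natural number M ≥ 1 and α ∈ (0,1). Then the (1 − α)-quantile of the chi-squared distribution with Mκ degrees of freedom tends to 0 as κ → 0⁺: lim_{κ→0⁺} F_χ⁻¹(1 − α; Mκ) = 0. -/
open Set Filter Topology

open MeasureTheory ProbabilityTheory in
/-- Markov's inequality for the Gamma distribution, whose mean is `a / r`. -/
lemma gammaMeasure_Ioi_le {a r x : ℝ} (ha : 0 < a) (hr : 0 < r) (hx : 0 < x) :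
    gammaMeasure a r (Ioi x) ≤ ENNReal.ofReal (a / (r * x)) := by
  have hpdf : ∀ y ∈ Ioi x,
      gammaPDF a r y ≤ ENNReal.ofReal (a / (r * x)) * gammaPDF (a + 1) r y := by
    intro y hy
    have hy0 : 0 < y := hx.trans hy
    rw [gammaPDF, gammaPDF, ← ENNReal.ofReal_mul (by positivity)]
    refine ENNReal.ofReal_le_ofReal ?_
    have hmul : a / (r * x) * gammaPDFReal (a + 1) r y = y / x * gammaPDFReal a r y := by
      have hΓ := (Real.Gamma_pos_of_pos ha).ne'
      simp only [gammaPDFReal, if_pos hy0.le]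
      rw [Real.Gamma_add_one ha.ne', Real.rpow_add_one hr.ne', add_sub_cancel_right,
        Real.rpow_sub_one hy0.ne']
      field_simp
    rw [hmul]
    exact le_mul_of_one_le_left (gammaPDFReal_nonneg ha hr y) ((one_le_div hx).2 (le_of_lt hy))
  calc gammaMeasure a r (Ioi x) = ∫⁻ y in Ioi x, gammaPDF a r y :=
        withDensity_apply _ measurableSet_Ioi
    _ ≤ ∫⁻ y in Ioi x, ENNReal.ofReal (a / (r * x)) * gammaPDF (a + 1) r y :=
        setLIntegral_mono' measurableSet_Ioi hpdf
    _ ≤ ∫⁻ y, ENNReal.ofReal (a / (r * x)) * gammaPDF (a + 1) r y :=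
        setLIntegral_le_lintegral _ _
    _ = ENNReal.ofReal (a / (r * x)) := by
        rw [lintegral_const_mul' _ _ ENNReal.ofReal_ne_top,
          lintegral_gammaPDF_eq_one (by positivity) hr, mul_one]

open MeasureTheory ProbabilityTheory in
lemma one_sub_div_le_chiSqCDF {κ x : ℝ} (hκ : 0 < κ) (hx : 0 < x) :
    1 - κ / x ≤ chiSqCDF κ x := by
  have : IsProbabilityMeasure (gammaMeasure (κ / 2) (1 / 2)) :=
    isProbabilityMeasure_gammaMeasure (by positivity) (by positivity)
  have htail : (gammaMeasure (κ / 2) (1 / 2)).real (Ioi x) ≤ κ / x := by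
    refine ENNReal.toReal_le_of_le_ofReal (by positivity) ?_
    convert gammaMeasure_Ioi_le (half_pos hκ) one_half_pos hx using 2
    field_simp
  rw [chiSqCDF, cdf_eq_real]
  rw [← compl_Iic, probReal_compl_eq_one_sub measurableSet_Iic] at htail
  linarith

open ProbabilityTheory in
lemma chiSqCDF_of_neg {κ x : ℝ} (hκ : 0 < κ) (hx : x < 0) : chiSqCDF κ x = 0 := by
  rw [chiSqCDF, cdf_gammaMeasure_eq_integral (by positivity) (by positivity)]
  refine MeasureTheory.setIntegral_eq_zero_of_forall_eq_zero fun y hy => ?_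
  exact if_neg (not_le.2 (lt_of_le_of_lt hy hx))

lemma nonneg_of_le_chiSqCDF {κ q x : ℝ} (hκ : 0 < κ) (hq : 0 < q) (h : q ≤ chiSqCDF κ x) :
    0 ≤ x := by
  by_contra! hx
  rw [chiSqCDF_of_neg hκ hx] at h
  exact hq.not_ge h

lemma chiSqInv_nonneg {κ q : ℝ} (hκ : 0 < κ) (hq : 0 < q) : 0 ≤ chiSqInv κ q :=
  Real.sInf_nonneg fun _ h => nonneg_of_le_chiSqCDF hκ hq h

lemma chiSqInv_one_sub_le {κ α : ℝ} (hκ : 0 < κ) (hα : α ∈ Ioo (0 : ℝ) 1) :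
    chiSqInv κ (1 - α) ≤ κ / α := by
  refine csInf_le ⟨0, fun _ h => nonneg_of_le_chiSqCDF hκ (sub_pos.2 hα.2) h⟩ ?_
  have h := one_sub_div_le_chiSqCDF hκ (div_pos hκ hα.1)
  rwa [div_div_cancel₀ hκ.ne'] at h

/-- For a fixed natural number `M ≥ 1` and `α ∈ (0,1)`, the
`(1 − α)`-quantile of the chi-squared distribution with `Mκ` degrees of freedom
tends to `0` as `κ → 0⁺`. -/
theorem chiSq_quantile_tendsto_zero
    (M : ℕ) (hM : 1 ≤ M) (α : ℝ) (hα : α ∈ Set.Ioo (0 : ℝ) 1) :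
    Tendsto (fun κ : ℝ => chiSqInv ((M : ℝ) * κ) (1 - α))
      (nhdsWithin 0 (Set.Ioi 0)) (nhds 0) := by
  have hpos : ∀ κ ∈ Ioi (0 : ℝ), 0 < (M : ℝ) * κ := fun κ hκ =>
    mul_pos (Nat.cast_pos.2 hM) hκ
  have hlim : Tendsto (fun κ : ℝ => (M : ℝ) * κ / α) (𝓝[>] 0) (𝓝 0) := by
    have hcont : Continuous fun κ : ℝ => (M : ℝ) * κ / α := by fun_prop
    simpa using (hcont.tendsto 0).mono_left nhdsWithin_le_nhds
  refine tendsto_of_tendsto_of_tendsto_of_le_of_le' tendsto_const_nhds hlim ?_ ?_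
  · filter_upwards [self_mem_nhdsWithin] with κ hκ
    exact chiSqInv_nonneg (hpos κ hκ) (sub_pos.2 hα.2)
  · filter_upwards [self_mem_nhdsWithin] with κ hκ
    exact chiSqInv_one_sub_le (hpos κ hκ) hα
end

section
/- Let a, b > 0 be reals and let f_{a,b}(x) = (Γ(a+b)/(Γ(a)Γ(b))) · x^{a−1} (1−x)^{b−1} be the Beta(a,b) density on (0,1), where Γ is the real Gamma function. Then x ↦ log f_{a,b}(x) is integrable on (0,1) and the Kullback–Leibler divergence of f_{a,b} from the uniform density satisfies D(u, f_{a,b}) = −∫₀¹ log f_{a,b}(x) dx = a + b + log( Γ(a)Γ(b)/Γ(a+b) ) − 2. -/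
open Set MeasureTheory

theorem log_const_mul_rpow_mul_one_sub_rpow {c x : ℝ} (hc : c ≠ 0) (hx : x ∈ Ioo (0 : ℝ) 1)
    (p q : ℝ) :
    Real.log (c * x ^ p * (1 - x) ^ q) =
      Real.log c + p * Real.log x + q * Real.log (1 - x) := by
  have h0 : 0 < x := hx.1
  have h1 : 0 < 1 - x := sub_pos.2 hx.2
  rw [Real.log_mul (mul_ne_zero hc (Real.rpow_pos_of_pos h0 p).ne')
      (Real.rpow_pos_of_pos h1 q).ne',
    Real.log_mul hc (Real.rpow_pos_of_pos h0 p).ne', Real.log_rpow h0, Real.log_rpow h1]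

theorem integrableOn_log_Ioo_zero_one : IntegrableOn Real.log (Ioo 0 1) :=
  (intervalIntegrable_iff_integrableOn_Ioo_of_le zero_le_one).1
    intervalIntegral.intervalIntegrable_log'

theorem integrableOn_log_one_sub_Ioo_zero_one :
    IntegrableOn (fun x : ℝ => Real.log (1 - x)) (Ioo 0 1) := by
  refine (intervalIntegrable_iff_integrableOn_Ioo_of_le zero_le_one).1 ?_
  simpa using
    ((intervalIntegral.intervalIntegrable_log' (a := 0) (b := 1)).comp_sub_left 1).symm

theorem setIntegral_log_Ioo_zero_one : ∫ x in Ioo (0 : ℝ) 1, Real.log x = -1 := by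
  rw [← integral_Ioc_eq_integral_Ioo, ← intervalIntegral.integral_of_le zero_le_one,
    integral_log]
  simp

theorem setIntegral_log_one_sub_Ioo_zero_one :
    ∫ x in Ioo (0 : ℝ) 1, Real.log (1 - x) = -1 := by
  rw [← integral_Ioc_eq_integral_Ioo, ← intervalIntegral.integral_of_le zero_le_one,
    intervalIntegral.integral_comp_sub_left Real.log, integral_log]
  simp

/-- For `a, b > 0` and the Beta(a,b) density
`f(x) = (Γ(a+b)/(Γ(a)Γ(b))) x^(a−1) (1−x)^(b−1)` on `(0,1)`, the function
`x ↦ log f(x)` is integrable on `(0,1)` and the KL divergence of `f` from the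
uniform density satisfies
`D(u,f) = −∫₀¹ log f(x) dx = a + b + log(Γ(a)Γ(b)/Γ(a+b)) − 2`. -/
theorem kl_uniform_beta
    (a b : ℝ) (ha : 0 < a) (hb : 0 < b) :
    IntegrableOn (fun x : ℝ =>
        Real.log ((Real.Gamma (a + b) / (Real.Gamma a * Real.Gamma b)) *
          x ^ (a - 1) * (1 - x) ^ (b - 1))) (Set.Ioo 0 1) ∧
    -(∫ x in Set.Ioo (0 : ℝ) 1,
        Real.log ((Real.Gamma (a + b) / (Real.Gamma a * Real.Gamma b)) *
          x ^ (a - 1) * (1 - x) ^ (b - 1)))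
      = a + b + Real.log (Real.Gamma a * Real.Gamma b / Real.Gamma (a + b)) - 2 := by
  have hc : Real.Gamma (a + b) / (Real.Gamma a * Real.Gamma b) ≠ 0 :=
    (div_pos (Real.Gamma_pos_of_pos (add_pos ha hb))
      (mul_pos (Real.Gamma_pos_of_pos ha) (Real.Gamma_pos_of_pos hb))).ne'
  have heq := fun (x : ℝ) (hx : x ∈ Ioo (0 : ℝ) 1) =>
    log_const_mul_rpow_mul_one_sub_rpow hc hx (a - 1) (b - 1)
  have hconst : IntegrableOn (fun _ : ℝ =>
      Real.log (Real.Gamma (a + b) / (Real.Gamma a * Real.Gamma b))) (Ioo 0 1) :=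
    integrableOn_const (by simp)
  have hx := integrableOn_log_Ioo_zero_one.const_mul (a - 1)
  have hy := integrableOn_log_one_sub_Ioo_zero_one.const_mul (b - 1)
  refine ⟨((hconst.add hx).add hy).congr_fun (fun x h => (heq x h).symm) measurableSet_Ioo, ?_⟩
  rw [setIntegral_congr_fun measurableSet_Ioo heq, integral_add (hconst.fun_add hx) hy,
    integral_add hconst hx, integral_const_mul, integral_const_mul,
    setIntegral_log_Ioo_zero_one, setIntegral_log_one_sub_Ioo_zero_one, setIntegral_const,
    ← inv_div (Real.Gamma (a + b)), Real.log_inv]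
  simp
  ring
end

section
/- Fix a real κ > 0 and p ∈ (0,1), and consider the chi-squared quantile pooled p-value at the constant vector (p,…,p) of length M: c_M = 1 − F_χ( M · F_χ⁻¹(1 − p; κ); Mκ ). As M → ∞ along the natural numbers: if p < 1 − F_χ(κ; κ) then c_M → 0, and if p > 1 − F_χ(κ; κ) then c_M → 1. In particular, the asymptotic central rejection threshold of the chi-squared quantile pooled p-value is p_c = 1 − F_χ(κ; κ). -/
open Set Filter Topology

open MeasureTheory ProbabilityTheory

/-- Chernoff bound for the Gamma distribution, by exponential tilting from rate `r` to rate `r'`. -/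
lemma gammaMeasure_real_le {a r r' y : ℝ} (ha : 0 < a) (hr : 0 < r) (hr' : 0 < r')
    {s : Set ℝ} (hs : MeasurableSet s) (hy : ∀ z ∈ s, (r' - r) * z ≤ (r' - r) * y) :
    (gammaMeasure a r).real s ≤ (r / r') ^ a * Real.exp ((r' - r) * y) := by
  set C := (r / r') ^ a * Real.exp ((r' - r) * y) with hC
  have hC0 : 0 ≤ C := by positivity
  have := isProbabilityMeasure_gammaMeasure ha hr'
  have hpdf : ∀ z ∈ s, gammaPDF a r z ≤ ENNReal.ofReal C * gammaPDF a r' z := by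
    intro z hz
    rw [gammaPDF, gammaPDF, ← ENNReal.ofReal_mul hC0]
    apply ENNReal.ofReal_le_ofReal
    unfold gammaPDFReal
    split_ifs with h0
    · have hG : 0 < Real.Gamma a := Real.Gamma_pos_of_pos ha
      have hexp : Real.exp (-(r * z)) ≤ Real.exp ((r' - r) * y) * Real.exp (-(r' * z)) := by
        rw [← Real.exp_add, Real.exp_le_exp]
        linarith [hy z hz]
      have hpow : (r / r') ^ a * r' ^ a = r ^ a := by
        rw [← Real.mul_rpow (by positivity) hr'.le, div_mul_cancel₀ _ hr'.ne']
      calc r ^ a / Real.Gamma a * z ^ (a - 1) * Real.exp (-(r * z))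
          ≤ r ^ a / Real.Gamma a * z ^ (a - 1) *
              (Real.exp ((r' - r) * y) * Real.exp (-(r' * z))) := by gcongr
        _ = C * (r' ^ a / Real.Gamma a * z ^ (a - 1) * Real.exp (-(r' * z))) := by
          rw [hC, ← hpow]; ring
    · simp
  apply ENNReal.toReal_le_of_le_ofReal hC0
  calc gammaMeasure a r s = ∫⁻ z in s, gammaPDF a r z := withDensity_apply _ hs
    _ ≤ ∫⁻ z in s, ENNReal.ofReal C * gammaPDF a r' z := setLIntegral_mono' hs hpdf
    _ = ENNReal.ofReal C * gammaMeasure a r' s := by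
      rw [lintegral_const_mul' _ _ ENNReal.ofReal_ne_top, gammaMeasure, withDensity_apply _ hs]
    _ ≤ ENNReal.ofReal C := mul_le_of_le_one_right' prob_le_one

/-- The Chernoff bound `gammaMeasure_real_le` at the optimal tilt, in chi-squared form. -/
lemma chiSq_real_le {κ x m : ℝ} (hκ : 0 < κ) (hx : 0 < x) (hm : 0 < m)
    {s : Set ℝ} (hs : MeasurableSet s) (hy : ∀ z ∈ s, (κ - x) * z ≤ (κ - x) * (m * x)) :
    (gammaMeasure (m * κ / 2) (1 / 2)).real s
      ≤ ((x / κ * Real.exp (1 - x / κ)) ^ (κ / 2)) ^ m := by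
  have hrate : κ / (2 * x) - 1 / 2 = (κ - x) * (1 / (2 * x)) := by field_simp
  refine (gammaMeasure_real_le (r' := κ / (2 * x)) (y := m * x) (by positivity) (by norm_num)
    (by positivity) hs fun z hz => ?_).trans_eq ?_
  · rw [hrate, mul_right_comm, mul_right_comm _ _ (m * x)]
    exact mul_le_mul_of_nonneg_right (hy z hz) (by positivity)
  · rw [← Real.rpow_mul (by positivity), Real.mul_rpow (by positivity) (by positivity),
      ← Real.exp_mul]
    congr 2
    · field_simp
    · ring
    · field_simp

lemma tendsto_chernoff_zero {κ x : ℝ} (hκ : 0 < κ) (hx : 0 < x) (hne : x ≠ κ) :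
    Tendsto (fun M : ℕ => ((x / κ * Real.exp (1 - x / κ)) ^ (κ / 2)) ^ (M : ℝ))
      atTop (𝓝 0) := by
  simp_rw [Real.rpow_natCast]
  apply tendsto_pow_atTop_nhds_zero_of_lt_one (by positivity)
  apply Real.rpow_lt_one (by positivity) _ (by positivity)
  have hne' : x / κ - 1 ≠ 0 := by
    rw [sub_ne_zero, Ne, div_eq_one_iff_eq hκ.ne']
    exact hne
  calc x / κ * Real.exp (1 - x / κ)
      < Real.exp (x / κ - 1) * Real.exp (1 - x / κ) := by
        gcongr
        linarith [Real.add_one_lt_exp hne']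
    _ = 1 := by rw [← Real.exp_add]; simp

lemma continuous_chiSqCDF {κ : ℝ} (hκ : 0 < κ) : Continuous (chiSqCDF κ) := by
  have := isProbabilityMeasure_gammaMeasure (half_pos hκ) (one_half_pos (α := ℝ))
  rw [continuous_iff_continuousAt]
  intro x
  rw [continuousAt_iff_continuous_left'_right']
  refine ⟨?_, ((cdf _).right_continuous x).mono Ioi_subset_Ici_self⟩
  have hmono := monotone_cdf (gammaMeasure (κ / 2) (1 / 2))
  rw [show chiSqCDF κ = cdf (gammaMeasure (κ / 2) (1 / 2)) from rfl,
    hmono.continuousWithinAt_Iio_iff_leftLim_eq]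
  have h0 : (cdf (gammaMeasure (κ / 2) (1 / 2))).measure {x} = 0 := by
    rw [measure_cdf]
    exact withDensity_absolutelyContinuous _ _ (measure_singleton x)
  rw [StieltjesFunction.measure_singleton, ENNReal.ofReal_eq_zero] at h0
  exact le_antisymm (hmono.leftLim_le le_rfl) (by linarith)

lemma bddBelow_setOf_le_chiSqCDF (κ : ℝ) {q : ℝ} (hq : 0 < q) :
    BddBelow {x : ℝ | q ≤ chiSqCDF κ x} := by
  obtain ⟨b, hb⟩ := ((tendsto_cdf_atBot (gammaMeasure (κ / 2) (1 / 2))).eventually_lt_const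
    hq).exists
  refine ⟨b, fun x hx => le_of_not_gt fun h => ?_⟩
  exact (hx.trans (monotone_cdf _ h.le)).not_gt hb

lemma le_chiSqCDF_chiSqInv {κ q : ℝ} (hκ : 0 < κ) (hq : q ∈ Ioo (0 : ℝ) 1) :
    q ≤ chiSqCDF κ (chiSqInv κ q) := by
  have hne : {x : ℝ | q ≤ chiSqCDF κ x}.Nonempty :=
    ((tendsto_cdf_atTop (gammaMeasure (κ / 2) (1 / 2))).eventually_const_le hq.2).exists
  exact (isClosed_le continuous_const (continuous_chiSqCDF hκ)).csInf_mem hne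
    (bddBelow_setOf_le_chiSqCDF κ hq.1)

lemma tendsto_one_sub_chiSqCDF_zero {κ x : ℝ} (hκ : 0 < κ) (hx : κ < x) :
    Tendsto (fun M : ℕ => 1 - chiSqCDF (M * κ) (M * x)) atTop (𝓝 0) := by
  refine squeeze_zero' (Eventually.of_forall fun M => sub_nonneg.2 (cdf_le_one _ _)) ?_
    (tendsto_chernoff_zero hκ (hκ.trans hx) hx.ne')
  filter_upwards [eventually_gt_atTop 0] with M hM
  have hM' : (0 : ℝ) < M := Nat.cast_pos.2 hM
  have := isProbabilityMeasure_gammaMeasure (half_pos (mul_pos hM' hκ)) (one_half_pos (α := ℝ))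
  rw [chiSqCDF, cdf_eq_real, ← probReal_compl_eq_one_sub measurableSet_Iic]
  refine chiSq_real_le hκ (hκ.trans hx) hM' measurableSet_Iic.compl fun z hz => ?_
  rw [compl_Iic] at hz
  exact mul_le_mul_of_nonpos_left (le_of_lt hz) (by linarith)

lemma tendsto_chiSqCDF_zero {κ x : ℝ} (hκ : 0 < κ) (hx0 : 0 < x) (hx : x < κ) :
    Tendsto (fun M : ℕ => chiSqCDF (M * κ) (M * x)) atTop (𝓝 0) := by
  refine squeeze_zero' (Eventually.of_forall fun M => cdf_nonneg _ _) ?_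
    (tendsto_chernoff_zero hκ hx0 hx.ne)
  filter_upwards [eventually_gt_atTop 0] with M hM
  have hM' : (0 : ℝ) < M := Nat.cast_pos.2 hM
  have := isProbabilityMeasure_gammaMeasure (half_pos (mul_pos hM' hκ)) (one_half_pos (α := ℝ))
  rw [chiSqCDF, cdf_eq_real]
  exact chiSq_real_le hκ hx0 hM' measurableSet_Iic fun z hz =>
    mul_le_mul_of_nonneg_left hz (by linarith)

/-- Fix `κ > 0` and `p ∈ (0,1)`, and consider the chi-squared
quantile pooled p-value at the constant vector of length `M`:
`c_M = 1 − F_χ(M · F_χ⁻¹(1 − p; κ); Mκ)`. As `M → ∞`: if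
`p < 1 − F_χ(κ; κ)` then `c_M → 0`, and if `p > 1 − F_χ(κ; κ)` then
`c_M → 1`; so the asymptotic central rejection threshold is `1 − F_χ(κ;κ)`. -/
theorem chiPool_constant_vector_limit
    (κ : ℝ) (hκ : 0 < κ) (p : ℝ) (hp : p ∈ Set.Ioo (0 : ℝ) 1) :
    (p < 1 - chiSqCDF κ κ →
      Tendsto (fun M : ℕ =>
          1 - chiSqCDF ((M : ℝ) * κ) ((M : ℝ) * chiSqInv κ (1 - p)))
        atTop (nhds 0)) ∧
    (1 - chiSqCDF κ κ < p →
      Tendsto (fun M : ℕ =>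
          1 - chiSqCDF ((M : ℝ) * κ) ((M : ℝ) * chiSqInv κ (1 - p)))
        atTop (nhds 1)) := by
  have hq : 1 - p ∈ Ioo (0 : ℝ) 1 := ⟨by linarith [hp.2], by linarith [hp.1]⟩
  refine ⟨fun h => tendsto_one_sub_chiSqCDF_zero hκ ?_, fun h => ?_⟩
  · by_contra! hle
    have hmono : chiSqCDF κ (chiSqInv κ (1 - p)) ≤ chiSqCDF κ κ := monotone_cdf _ hle
    linarith [le_chiSqCDF_chiSqInv hκ hq]
  · have hev : ∀ᶠ x in 𝓝[<] κ, 1 - p < chiSqCDF κ x ∧ x ∈ Ioo 0 κ :=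
      ((((continuous_chiSqCDF hκ).tendsto κ).mono_left nhdsWithin_le_nhds).eventually_const_lt
        (by linarith)).and (Ioo_mem_nhdsLT hκ)
    obtain ⟨x, hpx, hx0, hxκ⟩ := hev.exists
    have hle : chiSqInv κ (1 - p) ≤ x := csInf_le (bddBelow_setOf_le_chiSqCDF κ hq.1) hpx.le
    have hzero : Tendsto (fun M : ℕ => chiSqCDF (M * κ) (M * chiSqInv κ (1 - p)))
        atTop (𝓝 0) :=
      squeeze_zero (fun M => cdf_nonneg _ _)
        (fun M => monotone_cdf _ (mul_le_mul_of_nonneg_left hle M.cast_nonneg))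
        (tendsto_chiSqCDF_zero hκ hx0 hxκ)
    simpa using hzero.const_sub 1
end
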